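/- Let n be odd and C a principally generated cyclic code of length n over R = Z4[u]/(u^2). If C is a free R-module, then C has a monic generator g'(x) that divides x^n - 1 in R[x]. -/

import Mathlib

set_option maxSynthPendingDepth 3
set_option synthInstance.maxHeartbeats 400000

open DualNumber TrivSqZeroExt Polynomial

/-- The ring `R = ℤ₄[u]/(u²)`, realized as dual numbers over `ℤ₄`. -/
abbrev R4 := DualNumber (ZMod 4)

/-- A surjection from `R[X]` to a finite free `R`-algebra has a kernel with a monic generator. -/
lemma exists_monic_ker {R A : Type*} [CommRing R] [Nontrivial R] [CommRing A] [Algebra R A]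
    [Module.Finite R A] [Module.Free R A] (π : R[X] →ₐ[R] A) (hπ : Function.Surjective π) :
    ∃ g' : R[X], g'.Monic ∧ ∀ p, π p = 0 ↔ g' ∣ p := by
  set T : A →ₗ[R] A := LinearMap.mulLeft R (π X) with hT
  have hmon : T.charpoly.Monic := LinearMap.charpoly_monic T
  have hdeg : T.charpoly.natDegree = Module.finrank R A := LinearMap.charpoly_natDegree T
  have hπa : ∀ p, π p = aeval (π X) p := fun p => by
    rw [aeval_algHom_apply, aeval_X_left_apply]
  have haev : π T.charpoly = 0 := by
    have h := LinearMap.aeval_self_charpoly T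
    have h2 : T = Algebra.lmul R A (π X) := rfl
    rw [h2, aeval_algHom_apply] at h
    have h3 := LinearMap.congr_fun h 1
    rw [hπa]
    simpa [← h2] using h3
  refine ⟨T.charpoly, hmon, fun p => ⟨fun hp => ?_, ?_⟩⟩
  · have := hmon.free_adjoinRoot
    have := hmon.finite_adjoinRoot
    have hfr : Module.finrank R (AdjoinRoot T.charpoly) = Module.finrank R A := by
      rw [(AdjoinRoot.powerBasis' hmon).finrank, ← hdeg]; rfl
    let φ : AdjoinRoot T.charpoly →ₐ[R] A := AdjoinRoot.liftAlgHom T.charpoly (Algebra.ofId R A) (π X)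
      (by rw [hπa] at haev; exact haev)
    have hφ : ∀ q, φ (AdjoinRoot.mk _ q) = π q := fun q => by
      rw [hπa]
      exact AdjoinRoot.liftAlgHom_mk _ _ _ _ q
    let i := LinearEquiv.ofFinrankEq (R := R) (AdjoinRoot T.charpoly) A hfr
    have hinj : Function.Injective φ.toLinearMap := by
      refine OrzechProperty.injective_of_surjective_of_injective i.toLinearMap _ i.injective ?_
      intro a
      obtain ⟨q, rfl⟩ := hπ a
      exact ⟨AdjoinRoot.mk _ q, hφ q⟩
    rw [← AdjoinRoot.mk_eq_zero]
    apply hinj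
    rw [map_zero]
    exact (hφ p).trans hp
  · rintro ⟨q, rfl⟩
    rw [map_mul, haev, zero_mul]

lemma R4_nilp (r : R4) (h : (inr 2 : R4) * r = 0) : IsNilpotent r := by
  rw [isNilpotent_iff_isNilpotent_fst]
  have h2 := congrArg TrivSqZeroExt.snd h
  simp at h2
  refine ⟨2, ?_⟩
  revert h2
  generalize r.fst = a
  revert a
  decide

lemma R4_nontriv : Nontrivial R4 :=
  ⟨0, 1, fun h => absurd (congrArg TrivSqZeroExt.fst h) (by rw [fst_zero, fst_one]; decide)⟩

lemma R4_local : IsLocalRing R4 := by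
  have := R4_nontriv
  refine IsLocalRing.of_isUnit_or_isUnit_one_sub_self fun a => ?_
  rw [isUnit_iff_isUnit_fst, isUnit_iff_isUnit_fst]
  simp only [fst_sub, fst_one]
  generalize a.fst = b
  revert b
  decide

/-- Reduction to the residue field. -/
noncomputable def redHom : R4 →+* ZMod 2 :=
  (ZMod.castHom (by norm_num : 2 ∣ 4) (ZMod 2)).comp (fstHom (ZMod 4) (ZMod 4) (ZMod 4)).toRingHom

lemma redHom_apply (r : R4) : redHom r = ZMod.castHom (by norm_num : 2 ∣ 4) (ZMod 2) r.fst := rfl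

lemma redHom_surj : Function.Surjective redHom := by
  intro y
  obtain ⟨a, rfl⟩ := ZMod.castHom_surjective (by norm_num : 2 ∣ 4) y
  exact ⟨inl a, by simp [redHom_apply]⟩

lemma redHom_ker (r : R4) (h : redHom r = 0) : (inr 2 : R4) * r = 0 := by
  rw [redHom_apply] at h
  have : (2 : ZMod 4) * r.fst = 0 := by
    revert h
    generalize r.fst = a
    revert a
    decide
  ext
  · simp
  · simpa [mul_comm] using this

lemma exists_reg (n : ℕ) (hodd : Odd n) (g : R4[X]) :
    ∃ a b : R4[X], C (inr 2 : R4) * (g - a * g ^ 2 - b * (X ^ n - 1)) = 0 := by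
  classical
  set G := g.map redHom
  set F : (ZMod 2)[X] := X ^ n - 1 with hF
  have hsq : Squarefree F := by
    apply Separable.squarefree
    rw [hF, X_pow_sub_one_separable_iff]
    intro h
    rw [ZMod.natCast_eq_zero_iff] at h
    exact (Nat.not_even_iff_odd.mpr hodd) (even_iff_two_dvd.mpr h)
  have hd : EuclideanDomain.gcd (G ^ 2) F ∣ G := by
    have h1 : Squarefree (EuclideanDomain.gcd (G ^ 2) F) :=
      hsq.squarefree_of_dvd (EuclideanDomain.gcd_dvd_right _ _)
    exact (h1.dvd_pow_iff_dvd two_ne_zero).mp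
      (EuclideanDomain.gcd_dvd_left _ _)
  obtain ⟨k, hk⟩ := hd
  rw [EuclideanDomain.gcd_eq_gcd_ab] at hk
  obtain ⟨a, ha⟩ := Polynomial.map_surjective redHom redHom_surj
    (EuclideanDomain.gcdA (G ^ 2) F * k)
  obtain ⟨b, hb⟩ := Polynomial.map_surjective redHom redHom_surj
    (EuclideanDomain.gcdB (G ^ 2) F * k)
  refine ⟨a, b, ?_⟩
  have h0 : (g - a * g ^ 2 - b * (X ^ n - 1)).map redHom = 0 := by
    simp only [Polynomial.map_sub, Polynomial.map_mul, Polynomial.map_pow, map_X,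
      Polynomial.map_one, ha, hb]
    change G - _ * G ^ 2 - _ * F = 0
    linear_combination hk
  ext1 i
  rw [coeff_C_mul, coeff_zero]
  apply redHom_ker
  rw [← coeff_map, h0, coeff_zero]

/-- A principal ideal, free as a module, of an `R4`-algebra: regularity mod the socle annihilator
implies it is generated by an idempotent. -/
lemma exists_idem_gen {S : Type*} [CommRing S] [Algebra R4 S] (g a : S)
    (hfree : Module.Free R4 (Ideal.span {g}))
    (h : (inr 2 : R4) • (g - a * g ^ 2) = 0) :
    ∃ e : S, e * e = e ∧ Ideal.span {e} = Ideal.span {g} := by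
  have hc : g - a * g ^ 2 ∈ Ideal.span {g} :=
    Ideal.mem_span_singleton.mpr ⟨1 - a * g, by ring⟩
  let c : Ideal.span {g} := ⟨g - a * g ^ 2, hc⟩
  let B := Module.Free.chooseBasis R4 (Ideal.span {g})
  have htc : (inr 2 : R4) • c = 0 := Subtype.ext h
  have hnil : ∀ i, IsNilpotent (B.repr c i) := fun i => by
    apply R4_nilp
    have := congrArg (fun z => B.repr z i) htc
    simpa using this
  have hz : ∀ i, ∃ z, ((B i : Ideal.span {g}) : S) = g * z := fun i =>
    Ideal.mem_span_singleton.mp (B i).2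
  choose z hz using hz
  have hsum : g - a * g ^ 2 = g * ∑ i ∈ (B.repr c).support, (B.repr c i) • z i := by
    have h1 := B.linearCombination_repr c
    rw [Finsupp.linearCombination_apply, Finsupp.sum] at h1
    have h2 := congrArg (fun w : Ideal.span {g} => (w : S)) h1
    simp only [AddSubmonoidClass.coe_finsetSum] at h2
    rw [Finset.mul_sum]
    simp only [mul_smul_comm]
    refine h2.symm.trans (Finset.sum_congr rfl fun i _ => ?_)
    rw [← hz i]
    rfl
  set y := ∑ i ∈ (B.repr c).support, (B.repr c i) • z i with hy
  have hyn : IsNilpotent y := by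
    apply isNilpotent_sum
    intro i _
    rw [Algebra.smul_def]
    exact Commute.isNilpotent_mul_right (Commute.all _ _) ((hnil i).map (algebraMap R4 S))
  obtain ⟨v, hv⟩ := hyn.isUnit_one_sub.exists_right_inv
  have hg : g = v * a * g * g := by linear_combination (- g) * hv + v * hsum
  refine ⟨v * a * g, by linear_combination (-(v * a)) * hg, ?_⟩
  apply le_antisymm
  · rw [Ideal.span_singleton_le_span_singleton]; exact ⟨v * a, by ring⟩
  · rw [Ideal.span_singleton_le_span_singleton]; exact ⟨g, hg⟩

lemma free_quot {R S : Type*} [CommRing R] [IsLocalRing R] [CommRing S] [Algebra R S]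
    [Module.Finite R S] [Module.Free R S] (e : S) (he : e * e = e) :
    Module.Free R (S ⧸ Ideal.span {e}) := by
  let i : (S ⧸ Ideal.span {e}) →ₗ[S] S :=
    Submodule.liftQ (Ideal.span {e}) (LinearMap.mulLeft S (1 - e)) (by
      rw [Ideal.span, Submodule.span_le]
      rintro x rfl
      simp [sub_mul, he])
  let s : S →ₗ[S] (S ⧸ Ideal.span {e}) := (Ideal.span {e}).mkQ
  have : Module.Projective R (S ⧸ Ideal.span {e}) := by
    refine Module.Projective.of_split (i.restrictScalars R) (s.restrictScalars R) ?_
    refine LinearMap.ext fun x => ?_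
    obtain ⟨x, rfl⟩ := Ideal.Quotient.mk_surjective x
    change Ideal.Quotient.mk _ ((1 - e) * x) = Ideal.Quotient.mk _ x
    rw [Ideal.Quotient.eq, Ideal.mem_span_singleton]
    exact ⟨-x, by ring⟩
  have : Module.Finite R (S ⧸ Ideal.span {e}) :=
    Module.Finite.of_surjective (s.restrictScalars R) (Ideal.span {e}).mkQ_surjective
  exact Module.free_of_flat_of_isLocalRing

/-- Let `n` be odd and `C = ⟨g(x)⟩` a principally generated cyclic code of
length `n` over `R = ℤ₄[u]/(u²)`. If `C` is a free `R`-module, then `C` has a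
monic generator `g'` dividing `xⁿ - 1` in `R[x]`. -/
theorem stmt16 (n : ℕ) (hpos : 0 < n) (hodd : Odd n) (g : Polynomial R4)
    (hfree : Module.Free R4
      (Ideal.span {Ideal.Quotient.mk (Ideal.span {(X : Polynomial R4) ^ n - 1}) g})) :
    ∃ g' : Polynomial R4, g'.Monic ∧ g' ∣ (X : Polynomial R4) ^ n - 1 ∧
      Ideal.span {Ideal.Quotient.mk (Ideal.span {(X : Polynomial R4) ^ n - 1}) g'} =
      Ideal.span {Ideal.Quotient.mk (Ideal.span {(X : Polynomial R4) ^ n - 1}) g} := by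
  have := R4_local
  have hf : ((X : R4[X]) ^ n - 1).Monic := monic_X_pow_sub_C 1 hpos.ne'
  set I := Ideal.span {(X : R4[X]) ^ n - 1} with hI
  have : Module.Free R4 (R4[X] ⧸ I) := hf.free_quotient
  have : Module.Finite R4 (R4[X] ⧸ I) := hf.finite_quotient
  obtain ⟨a, b, hab⟩ := exists_reg n hodd g
  have hX : Ideal.Quotient.mk I (X ^ n - 1) = 0 :=
    Ideal.Quotient.eq_zero_iff_mem.mpr (Ideal.mem_span_singleton_self _)
  obtain ⟨e, he, hspan⟩ := exists_idem_gen (Ideal.Quotient.mk I g) (Ideal.Quotient.mk I a) hfree (by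
    have h := congrArg (Ideal.Quotient.mk I) hab
    rw [map_mul, map_sub, map_sub, map_mul, map_mul, hX, map_pow, mul_zero, sub_zero,
      map_zero] at h
    rw [Algebra.smul_def]
    exact h)
  have := free_quot (R := R4) e he
  have : Module.Finite R4 ((R4[X] ⧸ I) ⧸ Ideal.span {e}) :=
    Module.Finite.of_surjective ((Ideal.span {e}).mkQ.restrictScalars R4)
      (Ideal.span {e}).mkQ_surjective
  let π : R4[X] →ₐ[R4] ((R4[X] ⧸ I) ⧸ Ideal.span {e}) :=
    (Ideal.Quotient.mkₐ R4 (Ideal.span {e})).comp (Ideal.Quotient.mkₐ R4 I)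
  have hπ : Function.Surjective π :=
    (Ideal.Quotient.mk_surjective).comp (Ideal.Quotient.mk_surjective)
  have hπ0 : ∀ p, π p = 0 ↔ Ideal.Quotient.mk I p ∈ Ideal.span {e} := fun p =>
    Ideal.Quotient.eq_zero_iff_mem
  have hE := exists_monic_ker (R := R4) (A := (R4[X] ⧸ I) ⧸ Ideal.span {e}) π hπ
  obtain ⟨g', hmon, hker⟩ := hE
  refine ⟨g', hmon, ?_, ?_⟩
  · rw [← hker, hπ0, hX]
    exact zero_mem _
  · rw [← hspan]
    apply le_antisymm
    · rw [Ideal.span_singleton_le_iff_mem, ← hπ0, hker]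
    · rw [Ideal.span_singleton_le_iff_mem]
      obtain ⟨p, rfl⟩ := Ideal.Quotient.mk_surjective e
      have : g' ∣ p := by
        rw [← hker, hπ0]
        exact Ideal.mem_span_singleton_self _
      rw [Ideal.mem_span_singleton]
      exact map_dvd _ this
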